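/- Let p ∈ ℝ[x_1,…,x_d] be an RZ_{x⁰} polynomial with p(x⁰) > 0. Then the closure in ℝ^d of the connected component of x⁰ in the set {x ∈ ℝ^d : p(x) > 0} is a convex set. -/

import Mathlib

/-- A polynomial `p ∈ ℝ[x_1,…,x_d]` satisfies the real zero condition with respect to
`x⁰ ∈ ℝ^d` if for every `x ∈ ℝ^d`, every complex zero of the univariate polynomial
`t ↦ p(x⁰ + t·x)` is real. -/
def IsRZ {d : ℕ} (p : MvPolynomial (Fin d) ℝ) (x0 : Fin d → ℝ) : Prop :=
  ∀ x : Fin d → ℝ, ∀ t : ℂ,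
    MvPolynomial.aeval (fun i => (x0 i : ℂ) + t * (x i : ℂ)) p = 0 → t.im = 0

open Filter Topology Polynomial in
/-- A complex polynomial without zeros in a ball around `z` is bounded anywhere in terms of its
value at `z`. -/
theorem Polynomial.norm_eval_le_of_forall_mem_ball_ne_zero (f : ℂ[X]) {z : ℂ} {r : ℝ} (hr : 0 < r)
    (h : ∀ ρ ∈ Metric.ball z r, f.eval ρ ≠ 0) (w : ℂ) :
    ‖f.eval w‖ ≤ (1 + ‖w - z‖ / r) ^ f.natDegree * ‖f.eval z‖ := by
  have key : ∀ x : ℂ, ‖f.eval x‖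
      = ‖f.leadingCoeff‖ * (f.roots.map fun ρ => ‖x - ρ‖).prod := fun x => by
    rw [(IsAlgClosed.splits f).eval_eq_prod_roots, norm_mul]
    congr 1
    have := map_multiset_prod (normHom : ℂ →*₀ ℝ) (f.roots.map fun ρ => x - ρ)
    simpa [Multiset.map_map, Function.comp_def] using this
  have hprod : (f.roots.map fun ρ => ‖w - ρ‖).prod
      ≤ (f.roots.map fun ρ => (1 + ‖w - z‖ / r) * ‖z - ρ‖).prod := by
    refine Multiset.prod_map_le_prod_map₀ _ _ (fun _ _ => norm_nonneg _) fun ρ hρ => ?_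
    have hρz : r ≤ ‖z - ρ‖ := by
      by_contra! hlt
      refine h ρ ?_ (Polynomial.isRoot_of_mem_roots hρ)
      rwa [Metric.mem_ball, dist_comm, dist_eq_norm]
    have h1 : ‖w - z‖ ≤ ‖w - z‖ / r * ‖z - ρ‖ := by
      rw [div_mul_eq_mul_div, le_div_iff₀ hr]
      gcongr
    have h2 : ‖w - ρ‖ ≤ ‖w - z‖ + ‖z - ρ‖ := norm_sub_le_norm_sub_add_norm_sub _ _ _
    linarith
  rw [Multiset.prod_map_mul, Multiset.map_const', Multiset.prod_replicate,
    ← (IsAlgClosed.splits f).natDegree_eq_card_roots] at hprod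
  rw [key w, key z]
  calc _ ≤ ‖f.leadingCoeff‖ * _ := mul_le_mul_of_nonneg_left hprod (norm_nonneg _)
    _ = _ := by ring

namespace MvPolynomial

variable {d : ℕ} (p : MvPolynomial (Fin d) ℝ)

theorem aeval_ofReal (v : Fin d → ℝ) :
    aeval (fun i => (v i : ℂ)) p = ((eval v p : ℝ) : ℂ) := by
  induction p using MvPolynomial.induction_on with
  | C a => simp
  | add p q hp hq => simp [hp, hq]
  | mul_X p i hp => simp [hp]

theorem continuous_aeval_complex : Continuous fun v : Fin d → ℂ => aeval v p := by
  have : (fun v : Fin d → ℂ => aeval v p) = fun v => eval v (map (algebraMap ℝ ℂ) p) := by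
    ext v
    rw [eval_map, aeval_def]
  rw [this]
  exact continuous_eval _

theorem eval_aeval_line (A B : Fin d → ℂ) (x : ℂ) :
    (aeval (fun i => Polynomial.C (A i) + Polynomial.X * Polynomial.C (B i)) p).eval x
      = aeval (fun i => A i + x * B i) p := by
  induction p using MvPolynomial.induction_on with
  | C a => simp [IsScalarTower.algebraMap_apply ℝ ℂ (Polynomial ℂ)]
  | add p q hp hq => simp only [map_add, Polynomial.eval_add, hp, hq]
  | mul_X p i hp =>
    rw [map_mul, map_mul, Polynomial.eval_mul, hp, aeval_X, aeval_X]
    simp [mul_comm x]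

theorem norm_aeval_line_le {z : ℂ} {r : ℝ} (hr : 0 < r) (A B : Fin d → ℂ)
    (h : ∀ ρ ∈ Metric.ball z r, aeval (fun i => A i + ρ * B i) p ≠ 0) (w : ℂ) :
    ‖aeval (fun i => A i + w * B i) p‖
      ≤ (1 + ‖w - z‖ / r) ^ p.totalDegree * ‖aeval (fun i => A i + z * B i) p‖ := by
  set g : Fin d → Polynomial ℂ :=
    fun i => Polynomial.C (A i) + Polynomial.X * Polynomial.C (B i) with hg
  have hev : ∀ x : ℂ, (aeval g p).eval x = aeval (fun i => A i + x * B i) p :=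
    eval_aeval_line p A B
  have hdeg : (aeval (R := ℝ) g p).natDegree ≤ p.totalDegree := by
    rw [← mul_one p.totalDegree]
    let P : MvPolynomial (Fin d) ℂ := map (algebraMap ℝ ℂ) p
    have h2 : aeval (R := ℝ) g p = aeval (R := ℂ) g P := (aeval_map_algebraMap ℂ g p).symm
    rw [h2]
    refine aeval_natDegree_le P ?_ g fun i => ?_
    · exact Finset.sup_mono (support_map_subset _ _)
    · simp only [hg]
      compute_degree
  have h1 := (aeval g p).norm_eval_le_of_forall_mem_ball_ne_zero hr (z := z)
    (fun ρ hρ => by rw [hev]; exact h ρ hρ) w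
  rw [hev, hev] at h1
  refine h1.trans (mul_le_mul_of_nonneg_right (pow_le_pow_right₀ ?_ hdeg) (norm_nonneg _))
  have : 0 ≤ ‖w - z‖ / r := by positivity
  linarith

open Filter Topology in
/-- A form of Hurwitz's theorem for the restrictions of a polynomial to complex lines. -/
theorem aeval_line_ne_zero_of_tendsto {ι : Type*} {l : Filter ι} [l.NeBot]
    {A B : ι → Fin d → ℂ} {A₀ B₀ : Fin d → ℂ} (hA : Tendsto A l (𝓝 A₀)) (hB : Tendsto B l (𝓝 B₀))
    {z w : ℂ} {r : ℝ} (hr : 0 < r) (hw : aeval (fun i => A₀ i + w * B₀ i) p ≠ 0)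
    (h : ∀ᶠ j in l, ∀ ρ ∈ Metric.ball z r, aeval (fun i => A j i + ρ * B j i) p ≠ 0) :
    aeval (fun i => A₀ i + z * B₀ i) p ≠ 0 := by
  have hlim : ∀ x : ℂ, Tendsto (fun j => ‖aeval (fun i => A j i + x * B j i) p‖) l
      (𝓝 ‖aeval (fun i => A₀ i + x * B₀ i) p‖) := fun x => by
    refine (((continuous_aeval_complex p).tendsto _).comp ?_).norm
    rw [tendsto_pi_nhds] at *
    exact fun i => (hA i).add ((hB i).const_mul x)
  have hle := le_of_tendsto_of_tendsto (hlim w) ((hlim z).const_mul _)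
    (h.mono fun j hj => norm_aeval_line_le p hr (A j) (B j) hj w)
  intro h0
  rw [h0, norm_zero, mul_zero] at hle
  exact hw (norm_le_zero_iff.1 hle)

end MvPolynomial

open MvPolynomial Filter Topology

section

variable {d : ℕ} {p : MvPolynomial (Fin d) ℝ}

theorem aeval_ray (b x : Fin d → ℝ) (t : ℝ) :
    aeval (fun i => (b i : ℂ) + (t : ℂ) * (x i : ℂ)) p = ((eval (b + t • x) p : ℝ) : ℂ) := by
  rw [← aeval_ofReal]
  simp

theorem isOpen_setOf_forall_eval_ray_pos (p : MvPolynomial (Fin d) ℝ) (b : Fin d → ℝ) :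
    IsOpen {y : Fin d → ℝ | ∀ t ∈ Set.Icc (0 : ℝ) 1, 0 < eval (b + t • (y - b)) p} := by
  rw [isOpen_iff_mem_nhds]
  intro y hy
  refine isCompact_Icc.eventually_forall_of_forall_eventually fun t ht => ?_
  have hc : Continuous fun q : (Fin d → ℝ) × ℝ => eval (b + q.2 • (q.1 - b)) p :=
    (continuous_eval p).comp (by fun_prop)
  exact (hc.tendsto (y, t)).eventually (lt_mem_nhds (hy t ht))

/-- The component of `{p > 0}` around `b` is star-shaped about `b`. -/
theorem IsRZ.eval_ray_pos {b : Fin d → ℝ} (hRZ : IsRZ p b) (hb : 0 < eval b p) {y : Fin d → ℝ}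
    (hy : y ∈ connectedComponentIn {x : Fin d → ℝ | 0 < eval x p} b) :
    ∀ t ∈ Set.Icc (0 : ℝ) 1, 0 < eval (b + t • (y - b)) p := by
  set S := {y : Fin d → ℝ | ∀ t ∈ Set.Icc (0 : ℝ) 1, 0 < eval (b + t • (y - b)) p}
  suffices connectedComponentIn {x : Fin d → ℝ | 0 < eval x p} b ⊆ S from this hy
  refine isPreconnected_connectedComponentIn.subset_of_closure_inter_subset
    (isOpen_setOf_forall_eval_ray_pos p b) ⟨b, mem_connectedComponentIn hb, ?_⟩ ?_
  · intro t _
    simpa using hb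
  rintro x ⟨hx, hxC⟩ t ht
  have hxpos : x ∈ {x : Fin d → ℝ | 0 < eval x p} := connectedComponentIn_subset _ _ hxC
  have hnonneg : 0 ≤ eval (b + t • (x - b)) p := by
    have hc : Continuous fun y : Fin d → ℝ => eval (b + t • (y - b)) p :=
      (continuous_eval p).comp (by fun_prop)
    exact closure_minimal (fun y hy => (hy t ht).le) (isClosed_le continuous_const hc) hx
  refine hnonneg.lt_of_ne' fun h0 => ?_
  have ht0 : 0 < t := ht.1.lt_of_ne fun h => by
    subst h
    simp at h0
    exact hb.ne' h0
  have ht1 : t < 1 := ht.2.lt_of_ne fun h => by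
    subst h
    simp at h0
    exact hxpos.ne' h0
  have : (𝓝[S] x).NeBot := mem_closure_iff_nhdsWithin_neBot.1 hx
  have hB : Tendsto (fun (y : Fin d → ℝ) i => (((y - b) i : ℝ) : ℂ)) (𝓝[S] x)
      (𝓝 fun i => (((x - b) i : ℝ) : ℂ)) := by
    have hc : Continuous fun (y : Fin d → ℝ) i => (((y - b) i : ℝ) : ℂ) := by
      simp only [Pi.sub_apply]
      fun_prop
    exact hc.continuousWithinAt
  refine aeval_line_ne_zero_of_tendsto p (A := fun _ i => (b i : ℂ)) tendsto_const_nhds hB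
    (z := t) (w := 0) (r := min t (1 - t)) (lt_min ht0 (by linarith)) ?_ ?_ ?_
  · have := aeval_ofReal p b
    simp [this, hb.ne']
  · filter_upwards [self_mem_nhdsWithin] with y hy ρ hρ hzero
    have him := hRZ _ _ hzero
    lift ρ to ℝ using him
    rw [aeval_ray, Complex.ofReal_eq_zero] at hzero
    refine (hy _ ?_).ne' hzero
    rw [Metric.mem_ball, Complex.dist_of_im_eq (by simp), Real.dist_eq] at hρ
    have h1 := abs_lt.1 (hρ.trans_le (min_le_left _ _))
    have h2 := abs_lt.1 (hρ.trans_le (min_le_right _ _))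
    simp only [Complex.ofReal_re] at h1 h2
    constructor <;> linarith
  · rw [aeval_ray, h0, Complex.ofReal_zero]

/-- The direction `(1 - α) x - i α (a - b)` in which the point `a` is moved. -/
noncomputable def tiltedDirection (a b x : Fin d → ℝ) (α : ℝ) (i : Fin d) : ℂ :=
  ((1 - α : ℝ) : ℂ) * (x i : ℂ) - Complex.I * (α : ℂ) * ((a i : ℂ) - (b i : ℂ))

theorem continuous_tiltedDirection (a b x : Fin d → ℝ) : Continuous (tiltedDirection a b x) := by
  unfold tiltedDirection
  fun_prop

theorem aeval_tilted_zero (a b x : Fin d → ℝ) (α : ℝ) :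
    aeval (fun i => (a i : ℂ) + 0 * tiltedDirection a b x α i) p = ((eval a p : ℝ) : ℂ) := by
  simp [aeval_ofReal p a]

/-- There are no zeros on the circle `-Im u = α |u|²`. -/
theorem IsRZ.aeval_tilted_ne_zero_of_circle {b a : Fin d → ℝ} (hRZ : IsRZ p b)
    (ha : 0 < eval a p) (x : Fin d → ℝ) {α : ℝ} (hα : 0 < α) {u : ℂ}
    (hu : -u.im = α * Complex.normSq u) :
    aeval (fun i => (a i : ℂ) + u * tiltedDirection a b x α i) p ≠ 0 := by
  intro h
  rcases eq_or_ne u 0 with rfl | hu0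
  · rw [aeval_tilted_zero, Complex.ofReal_eq_zero] at h
    exact ha.ne' h
  have hn : 0 < Complex.normSq u := Complex.normSq_pos.2 hu0
  set r := u.re / Complex.normSq u with hr
  have hinv : u * (r + α * Complex.I) = 1 := by
    have h1 : (r + α * Complex.I : ℂ) = u⁻¹ := by
      apply Complex.ext
      · simp [hr]
      · simp [hu]
        field_simp
    rw [h1, mul_inv_cancel₀ hu0]
  have him : u.im = 0 := by
    refine hRZ (r • (a - b) + (1 - α) • x) u ?_
    rw [← h]
    congr 2
    ext i
    simp only [tiltedDirection, Pi.add_apply, Pi.smul_apply, Pi.sub_apply, smul_eq_mul]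
    push_cast
    linear_combination ((a i : ℂ) - b i) * hinv
  rw [him, neg_zero] at hu
  exact (mul_pos hα hn).ne hu

/-- There are no zeros in the disc `|u|² ≤ -Im u` for `α = 1`. -/
theorem IsRZ.aeval_tilted_one_ne_zero {b a : Fin d → ℝ} (hRZ : IsRZ p b)
    (hab : ∀ t ∈ Set.Icc (0 : ℝ) 1, 0 < eval (b + t • (a - b)) p) (x : Fin d → ℝ) {u : ℂ}
    (hu : Complex.normSq u ≤ -u.im) :
    aeval (fun i => (a i : ℂ) + u * tiltedDirection a b x 1 i) p ≠ 0 := by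
  intro h
  have h1 : aeval (fun i => (b i : ℂ) + (1 - Complex.I * u) * (((a - b) i : ℝ) : ℂ)) p = 0 := by
    rw [← h]
    congr 2
    ext i
    simp [tiltedDirection]
    ring
  have hre : u.re = 0 := by simpa using hRZ _ _ h1
  have h2 : (1 - Complex.I * u) = ((1 + u.im : ℝ) : ℂ) := by
    apply Complex.ext <;> simp [hre]
  rw [h2, aeval_ray, Complex.ofReal_eq_zero] at h1
  refine (hab _ ?_).ne' h1
  rw [Complex.normSq_apply, hre] at hu
  constructor <;> nlinarith

/-- Zeros in the open disc `α |u|² < -Im u` persist for slightly larger `α`. -/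
theorem exists_aeval_tilted_eq_zero_of_lt {b a : Fin d → ℝ} (ha : 0 < eval a p) (x : Fin d → ℝ)
    {α : ℝ} (hα1 : α < 1) {u : ℂ} (hu : α * Complex.normSq u < -u.im)
    (h : aeval (fun i => (a i : ℂ) + u * tiltedDirection a b x α i) p = 0) :
    ∃ β ∈ Set.Ioc α 1, ∃ v : ℂ, β * Complex.normSq v ≤ -v.im ∧
      aeval (fun i => (a i : ℂ) + v * tiltedDirection a b x β i) p = 0 := by
  by_contra! hno
  have hopen : IsOpen {q : ℝ × ℂ | q.1 * Complex.normSq q.2 < -q.2.im} := by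
    have := Complex.continuous_normSq
    exact isOpen_lt (by fun_prop) (by fun_prop)
  obtain ⟨δ, hδ, hball⟩ := Metric.isOpen_iff.1 hopen (α, u) hu
  refine aeval_line_ne_zero_of_tendsto p (l := 𝓝[>] α) (A := fun _ i => (a i : ℂ))
    (B := tiltedDirection a b x) tendsto_const_nhds
    ((continuous_tiltedDirection a b x).continuousWithinAt) (z := u) (w := 0) hδ ?_ ?_ h
  · rw [aeval_tilted_zero]
    exact_mod_cast ha.ne'
  · filter_upwards [Ioc_mem_nhdsGT hα1, mem_nhdsWithin_of_mem_nhds (Metric.ball_mem_nhds α hδ)]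
      with β hβ hβδ ρ hρ
    have hmem : (β, ρ) ∈ Metric.ball (α, u) δ := by
      rw [← ball_prod_same]
      exact ⟨hβδ, hρ⟩
    exact hno β hβ ρ (le_of_lt (hball hmem))

theorem IsRZ.aeval_ne_zero_of_im_neg {b a : Fin d → ℝ} (hRZ : IsRZ p b)
    (hab : ∀ t ∈ Set.Icc (0 : ℝ) 1, 0 < eval (b + t • (a - b)) p) (x : Fin d → ℝ) {u : ℂ}
    (hu : u.im < 0) : aeval (fun i => (a i : ℂ) + u * (x i : ℂ)) p ≠ 0 := by
  intro h
  have ha : 0 < eval a p := by simpa using hab 1 (by simp)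
  obtain ⟨δ, hδ, v, hv, hv0⟩ := exists_aeval_tilted_eq_zero_of_lt (b := b) ha x zero_lt_one
    (u := u) (by simpa using hu) (by simpa [tiltedDirection] using h)
  set K : Set (ℝ × ℂ) := {q | q.1 ∈ Set.Icc δ 1 ∧ q.1 * Complex.normSq q.2 ≤ -q.2.im ∧
    aeval (fun i => (a i : ℂ) + q.2 * tiltedDirection a b x q.1 i) p = 0}
  have hclosed : IsClosed K := by
    have h1 := Complex.continuous_normSq
    have h2 := continuous_tiltedDirection a b x
    have h3 : Continuous fun q : ℝ × ℂ =>
        aeval (fun i => (a i : ℂ) + q.2 * tiltedDirection a b x q.1 i) p :=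
      (continuous_aeval_complex p).comp <| continuous_pi fun i =>
        continuous_const.add (continuous_snd.mul (((continuous_apply i).comp h2).comp
          continuous_fst))
    have h4 : IsClosed {q : ℝ × ℂ | q.1 * Complex.normSq q.2 ≤ -q.2.im} :=
      isClosed_le (by fun_prop) (by fun_prop)
    exact (isClosed_Icc.preimage continuous_fst).inter
      (h4.inter (isClosed_eq h3 continuous_const))
  have hcompact : IsCompact K := by
    refine ((isCompact_Icc (a := δ) (b := 1)).prod (isCompact_closedBall (0 : ℂ) δ⁻¹)).of_isClosed_subset hclosed ?_
    rintro ⟨β, w⟩ ⟨hβ, hw, -⟩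
    refine ⟨hβ, ?_⟩
    rw [mem_closedBall_zero_iff]
    simp only at hβ hw
    rw [Complex.normSq_eq_norm_sq] at hw
    have h1 : -w.im ≤ ‖w‖ := (neg_le_abs _).trans (Complex.abs_im_le_norm w)
    rcases (norm_nonneg w).eq_or_lt with h0 | h0
    · rw [← h0]
      exact inv_nonneg.2 hδ.1.le
    · rw [← one_div, le_div_iff₀ hδ.1]
      have : δ * ‖w‖ ^ 2 ≤ β * ‖w‖ ^ 2 := by gcongr; exact hβ.1
      nlinarith
  obtain ⟨⟨β, w⟩, ⟨hβ, hw, hw0⟩, hmax⟩ :=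
    hcompact.exists_isMaxOn ⟨(δ, v), ⟨le_rfl, hδ.2⟩, hv, hv0⟩ continuous_fst.continuousOn
  simp only at hβ hw hw0
  have hβ0 : 0 < β := hδ.1.trans_le hβ.1
  have hβ1 : β < 1 := hβ.2.lt_of_ne fun h1 => by
    subst h1
    exact hRZ.aeval_tilted_one_ne_zero hab x (by simpa using hw) hw0
  have hlt : β * Complex.normSq w < -w.im := hw.lt_of_ne fun h1 =>
    hRZ.aeval_tilted_ne_zero_of_circle ha x hβ0 h1.symm hw0
  obtain ⟨γ, hγ, y, hy, hy0⟩ := exists_aeval_tilted_eq_zero_of_lt ha x hβ1 hlt hw0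
  have : γ ≤ β := hmax (a := (γ, y)) ⟨⟨hβ.1.trans hγ.1.le, hγ.2⟩, hy, hy0⟩
  exact absurd hγ.1 this.not_gt

/-- The real zero condition carries over to points visible from the base point in `{p > 0}`. -/
theorem IsRZ.of_eval_ray_pos {b a : Fin d → ℝ} (hRZ : IsRZ p b)
    (hab : ∀ t ∈ Set.Icc (0 : ℝ) 1, 0 < eval (b + t • (a - b)) p) : IsRZ p a := by
  intro x t h
  rcases lt_trichotomy t.im 0 with ht | ht | ht
  · exact absurd h (hRZ.aeval_ne_zero_of_im_neg hab x ht)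
  · exact ht
  · refine absurd ?_ (hRZ.aeval_ne_zero_of_im_neg hab (-x) (u := -t) (by simpa using ht))
    simpa using h

end

/-- If `p` is an `RZ_{x⁰}` polynomial with `p(x⁰) > 0`, then the closure of the
connected component of `x⁰` in `{p > 0}` is convex. -/
theorem stmt4 {d : ℕ} (p : MvPolynomial (Fin d) ℝ) (x0 : Fin d → ℝ)
    (hRZ : IsRZ p x0) (hpos : 0 < MvPolynomial.eval x0 p) :
    Convex ℝ (closure (connectedComponentIn
      {x : Fin d → ℝ | 0 < MvPolynomial.eval x p} x0)) := by
  refine Convex.closure (convex_iff_segment_subset.2 fun a ha c hc => ?_)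
  have haRZ : IsRZ p a := hRZ.of_eval_ray_pos (hRZ.eval_ray_pos hpos ha)
  have hapos : a ∈ {x : Fin d → ℝ | 0 < eval x p} := connectedComponentIn_subset _ _ ha
  rw [connectedComponentIn_eq ha] at hc ⊢
  refine (convex_segment a c).isPreconnected.subset_connectedComponentIn
    (left_mem_segment ℝ a c) ?_
  rw [segment_eq_image']
  rintro _ ⟨t, ht, rfl⟩
  exact haRZ.eval_ray_pos hapos hc t ht
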